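/- arXiv:math/0503006 — 2 statements merged into one kernel-verified Lean document; each statement's English description precedes it below -/
import Mathlib

section
/- (Theorem 3.1, first direction.) Let I be a transport along paths in (E,π,B) satisfying conditions (1.5) and (1.6). Then the map φ : γ ↦ φ_γ := I^γ_{a→b} (for γ : [a,b] → B) is an axiomatically defined parallel transport: each φ_γ : π⁻¹(γ(a)) → π⁻¹(γ(b)) is a bijection and φ satisfies properties (2.11), (2.12), (2.13) and (2.14). -/
open Set Function

variable {E B : Type*}

/-- The fibre of `π : E → B` over `x : B`. -/
def Fibre (π : E → B) (x : B) : Set E := {u : E | π u = x}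

/-- The left endpoint of `[a,b]` as an element of `Set.Icc a b`. -/
def lpt {a b : ℝ} (hab : a ≤ b) : Icc a b := ⟨a, Set.left_mem_Icc.mpr hab⟩

/-- The right endpoint of `[a,b]` as an element of `Set.Icc a b`. -/
def rpt {a b : ℝ} (hab : a ≤ b) : Icc a b := ⟨b, Set.right_mem_Icc.mpr hab⟩

/-- Restriction of a path `γ : [a,b] → B` to a subinterval `[c,d] ⊆ [a,b]`. -/
def restr {a b c d : ℝ} (γ : Icc a b → B) (h : Icc c d ⊆ Icc a b) : Icc c d → B :=
  γ ∘ Set.inclusion h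

/-- A transport along paths in the fibre bundle `(E, π, B)`: to every path
`γ : [a,b] → B` and all `s, t ∈ [a,b]` it assigns a map `I a b γ s t : E → E` mapping
the fibre over `γ s` into the fibre over `γ t` (values outside this fibre are
irrelevant), satisfying (1.2) and (1.3) on the fibres. -/
structure TransportAlongPaths (π : E → B) where
  I : ∀ (a b : ℝ), (Icc a b → B) → Icc a b → Icc a b → E → E
  maps_fibre : ∀ (a b : ℝ) (γ : Icc a b → B) (s t : Icc a b) (u : E),
    π u = γ s → π (I a b γ s t u) = γ t
  comp : ∀ (a b : ℝ) (γ : Icc a b → B) (r s t : Icc a b) (u : E),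
    π u = γ s → I a b γ t r (I a b γ s t u) = I a b γ s r u
  id_eq : ∀ (a b : ℝ) (γ : Icc a b → B) (s : Icc a b) (u : E),
    π u = γ s → I a b γ s s u = u

/-- Condition (1.5): invariance under restriction to subintervals. -/
def Cond15 (π : E → B) (I : ∀ (a b : ℝ), (Icc a b → B) → Icc a b → Icc a b → E → E) : Prop :=
  ∀ (a b c d : ℝ) (γ : Icc a b → B) (h : Icc c d ⊆ Icc a b) (s t : Icc c d) (u : E),
    π u = γ (Set.inclusion h s) →
      I c d (restr γ h) s t u = I a b γ (Set.inclusion h s) (Set.inclusion h t) u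

/-- Condition (1.6), for arbitrary (one-to-one, onto) reparametrizations of intervals. -/
def Cond16 (π : E → B) (I : ∀ (a b : ℝ), (Icc a b → B) → Icc a b → Icc a b → E → E) : Prop :=
  ∀ (a b c d : ℝ) (γ : Icc a b → B) (τ : Icc c d → Icc a b), Function.Bijective τ →
    ∀ (s t : Icc c d) (u : E), π u = γ (τ s) →
      I c d (γ ∘ τ) s t u = I a b γ (τ s) (τ t) u

/-- Condition (1.6) (= (4.4)) restricted to strictly increasing bijections. -/
def Cond16Inc (π : E → B) (I : ∀ (a b : ℝ), (Icc a b → B) → Icc a b → Icc a b → E → E) : Prop :=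
  ∀ (a b c d : ℝ) (γ : Icc a b → B) (τ : Icc c d → Icc a b),
    Function.Bijective τ → StrictMono τ →
    ∀ (s t : Icc c d) (u : E), π u = γ (τ s) →
      I c d (γ ∘ τ) s t u = I a b γ (τ s) (τ t) u

/-- The parallel transport `φ_γ := I^γ_{a→b}` assigned to a path `γ : [a,b] → B`. -/
def ppt (π : E → B) (T : TransportAlongPaths π) {a b : ℝ} (hab : a ≤ b)
    (γ : Icc a b → B) : E → E :=
  T.I a b γ (lpt hab) (rpt hab)

/-- The parallel transport `φ : γ ↦ φ_γ := I^γ_{a→b}` as a family over all paths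
(with a junk value for paths on empty intervals). -/
noncomputable def pTrans (π : E → B) (T : TransportAlongPaths π) (a b : ℝ)
    (γ : Icc a b → B) : E → E :=
  if hab : a ≤ b then T.I a b γ (lpt hab) (rpt hab) else id

/-- The canonically inverse path `γ₋(s) := γ(1-s)` of a path `γ : [0,1] → B`. -/
def inv01 (γ : Icc (0:ℝ) 1 → B) : Icc (0:ℝ) 1 → B := fun s =>
  γ ⟨1 - s.1, Set.mem_Icc.mpr ⟨by have := s.2.2; linarith, by have := s.2.1; linarith⟩⟩

/-- The canonically inverse path `η₋ := η ∘ τᶜ₋`, `τᶜ₋(s) := a + b - s`, of `η : [a,b] → B`. -/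
def invIcc {a b : ℝ} (γ : Icc a b → B) : Icc a b → B := fun s =>
  γ ⟨a + b - s.1, Set.mem_Icc.mpr ⟨by have := s.2.2; linarith, by have := s.2.1; linarith⟩⟩

/-- The canonical product of paths `γ₁, γ₂ : [0,1] → B`: `(γ₁γ₂)(s) = γ₁(2s)` for
`s ∈ [0,1/2]` and `(γ₁γ₂)(s) = γ₂(2s-1)` for `s ∈ [1/2,1]`. -/
noncomputable def prod01 (γ₁ γ₂ : Icc (0:ℝ) 1 → B) : Icc (0:ℝ) 1 → B := fun s =>
  if h : s.1 ≤ 1/2 then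
    γ₁ ⟨2 * s.1, Set.mem_Icc.mpr ⟨by have := s.2.1; linarith, by linarith⟩⟩
  else
    γ₂ ⟨2 * s.1 - 1, Set.mem_Icc.mpr ⟨by push_neg at h; linarith, by have := s.2.2; linarith⟩⟩

/-- Each `φ_γ` is a bijection from the fibre over `γ(a)` onto the fibre over `γ(b)`. -/
def PhiBij (π : E → B) (Φ : ∀ (a b : ℝ), (Icc a b → B) → E → E) : Prop :=
  ∀ (a b : ℝ) (hab : a ≤ b) (γ : Icc a b → B),
    Set.BijOn (Φ a b γ) (Fibre π (γ (lpt hab))) (Fibre π (γ (rpt hab)))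

/-- Property (2.11): invariance under orientation preserving reparametrizations. -/
def Cond211 (π : E → B) (Φ : ∀ (a b : ℝ), (Icc a b → B) → E → E) : Prop :=
  ∀ (a b c d : ℝ) (hab : a ≤ b) (hcd : c ≤ d) (γ : Icc a b → B)
    (τ : Icc c d → Icc a b), Function.Bijective τ → StrictMono τ →
    ∀ u : E, π u = γ (lpt hab) → Φ c d (γ ∘ τ) u = Φ a b γ u

/-- Property (2.12): `φ_{γ₋} = (φ_γ)⁻¹` as maps between the fibres over `γ(0)` and `γ(1)`. -/
def Cond212 (π : E → B) (Φ : ∀ (a b : ℝ), (Icc a b → B) → E → E) : Prop :=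
  ∀ γ : Icc (0:ℝ) 1 → B,
    (∀ u : E, π u = γ (lpt zero_le_one) → Φ 0 1 (inv01 γ) (Φ 0 1 γ u) = u) ∧
    (∀ u : E, π u = γ (rpt zero_le_one) → Φ 0 1 γ (Φ 0 1 (inv01 γ) u) = u)

/-- Property (2.13): `φ_{γ₁γ₂} = φ_{γ₂} ∘ φ_{γ₁}` on the fibre over `γ₁(0)`. -/
def Cond213 (π : E → B) (Φ : ∀ (a b : ℝ), (Icc a b → B) → E → E) : Prop :=
  ∀ γ₁ γ₂ : Icc (0:ℝ) 1 → B, γ₁ (rpt zero_le_one) = γ₂ (lpt zero_le_one) →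
    ∀ u : E, π u = γ₁ (lpt zero_le_one) →
      Φ 0 1 (prod01 γ₁ γ₂) u = Φ 0 1 γ₂ (Φ 0 1 γ₁ u)

/-- Property (2.14): the transport assigned to a one-point path is the identity on the fibre. -/
def Cond214 (π : E → B) (Φ : ∀ (a b : ℝ), (Icc a b → B) → E → E) : Prop :=
  ∀ (a : ℝ) (γ : Icc a a → B) (u : E), π u = γ (lpt le_rfl) → Φ a a γ u = u

/-- An axiomatically defined parallel transport in `(E, π, B)`: every `φ_γ` is a
bijection between the corresponding fibres and (2.11)-(2.14) hold. -/
structure IsParTransport (π : E → B) (Φ : ∀ (a b : ℝ), (Icc a b → B) → E → E) : Prop where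
  bij : PhiBij π Φ
  par211 : Cond211 π Φ
  par212 : Cond212 π Φ
  par213 : Cond213 π Φ
  par214 : Cond214 π Φ

/-- The transport along paths induced by a parallel transport:
`I^γ_{s→t} := φ_{γ|[a,t]} ∘ (φ_{γ|[a,s]})⁻¹`, where `(φ_{γ|[a,s]})⁻¹` is the inverse of
the bijection `φ_{γ|[a,s]}` from the fibre over `γ(a)` onto the fibre over `γ(s)`. -/
noncomputable def indTransport [Nonempty E] (π : E → B)
    (Φ : ∀ (a b : ℝ), (Icc a b → B) → E → E) (a b : ℝ) (γ : Icc a b → B)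
    (s t : Icc a b) : E → E := fun v =>
  Φ a t.1 (restr γ (Set.Icc_subset_Icc le_rfl t.2.2))
    (Function.invFunOn (Φ a s.1 (restr γ (Set.Icc_subset_Icc le_rfl s.2.2)))
      (Fibre π (γ ⟨a, Set.left_mem_Icc.mpr (le_trans s.2.1 s.2.2)⟩)) v)

theorem strictMono_bijective_lpt {a b c d : ℝ} (hab : a ≤ b) (hcd : c ≤ d)
    {τ : Icc c d → Icc a b} (hτ : Bijective τ) (hm : StrictMono τ) :
    τ (lpt hcd) = lpt hab := by
  obtain ⟨x, hx⟩ := hτ.2 (lpt hab)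
  apply le_antisymm
  · rw [← hx]
    exact hm.monotone (show c ≤ x.1 from x.2.1)
  · exact (τ (lpt hcd)).2.1

theorem strictMono_bijective_rpt {a b c d : ℝ} (hab : a ≤ b) (hcd : c ≤ d)
    {τ : Icc c d → Icc a b} (hτ : Bijective τ) (hm : StrictMono τ) :
    τ (rpt hcd) = rpt hab := by
  obtain ⟨x, hx⟩ := hτ.2 (rpt hab)
  apply le_antisymm
  · exact (τ (rpt hcd)).2.2
  · rw [← hx]
    exact hm.monotone (show x.1 ≤ d from x.2.2)

theorem pTrans_of_le (π : E → B) (T : TransportAlongPaths π) {a b : ℝ} (hab : a ≤ b)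
    (γ : Icc a b → B) : pTrans π T a b γ = T.I a b γ (lpt hab) (rpt hab) :=
  dif_pos hab

theorem transport_inv (π : E → B) (T : TransportAlongPaths π) {a b : ℝ}
    (γ : Icc a b → B) (s t : Icc a b) (u : E) (hu : π u = γ s) :
    T.I a b γ t s (T.I a b γ s t u) = u := by
  rw [T.comp a b γ s s t u hu, T.id_eq a b γ s u hu]

/-- If the restriction of `η` to a subinterval is a reparametrization of `γ`, then the
transports along `η` within this subinterval are those along `γ`. -/
theorem transport_eq_of_restr_eq_comp (π : E → B) (T : TransportAlongPaths π)
    (h15 : Cond15 π T.I) (h16 : Cond16 π T.I) {a b c d p q : ℝ}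
    (γ : Icc a b → B) (η : Icc p q → B) (h : Icc c d ⊆ Icc p q)
    (σ : Icc c d → Icc a b) (hσ : Bijective σ) (hη : restr η h = γ ∘ σ)
    (s t : Icc c d) (u : E) (hu : π u = γ (σ s)) :
    T.I p q η (inclusion h s) (inclusion h t) u = T.I a b γ (σ s) (σ t) u := by
  rw [← h15 p q c d η h s t u (hu.trans (congrFun hη s).symm), hη, h16 a b c d γ σ hσ s t u hu]

theorem pTrans_inv01 (π : E → B) (T : TransportAlongPaths π) (h16 : Cond16 π T.I)
    (γ : Icc (0:ℝ) 1 → B) (u : E) (hu : π u = γ (rpt zero_le_one)) :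
    pTrans π T 0 1 (inv01 γ) u = T.I 0 1 γ (rpt zero_le_one) (lpt zero_le_one) u := by
  let τ : Icc (0:ℝ) 1 → Icc (0:ℝ) 1 := fun s =>
    ⟨1 - s.1, by have := s.2.2; linarith, by have := s.2.1; linarith⟩
  have hτ : Involutive τ := fun s => Subtype.ext (sub_sub_cancel 1 s.1)
  have hl : τ (lpt zero_le_one) = rpt zero_le_one := Subtype.ext (sub_zero 1)
  have hr : τ (rpt zero_le_one) = lpt zero_le_one := Subtype.ext (sub_self 1)
  have key := h16 0 1 0 1 γ τ hτ.bijective (lpt zero_le_one) (rpt zero_le_one) u (by rw [hl, hu])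
  rw [hl, hr] at key
  rw [pTrans_of_le π T zero_le_one]
  exact key

theorem pTrans_prod01 (π : E → B) (T : TransportAlongPaths π)
    (h15 : Cond15 π T.I) (h16 : Cond16 π T.I) : Cond213 π (pTrans π T) := by
  intro γ₁ γ₂ hγ u hu
  have h₀ : (0:ℝ) ≤ 1/2 := by norm_num
  have h₁ : (1/2:ℝ) ≤ 1 := by norm_num
  let σ₁ : Icc (0:ℝ) (1/2) → Icc (0:ℝ) 1 := fun s =>
    ⟨2 * s.1, by have := s.2.1; linarith, by have := s.2.2; linarith⟩
  let σ₂ : Icc (1/2:ℝ) 1 → Icc (0:ℝ) 1 := fun s =>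
    ⟨2 * s.1 - 1, by have := s.2.1; linarith, by have := s.2.2; linarith⟩
  have hσ₁ : Bijective σ₁ := by
    refine ⟨fun s t hst => Subtype.ext ?_, fun y => ?_⟩
    · have : 2 * s.1 = 2 * t.1 := congrArg Subtype.val hst
      linarith
    · exact ⟨⟨y.1 / 2, by have := y.2.1; linarith, by have := y.2.2; linarith⟩,
        Subtype.ext (show 2 * (y.1 / 2) = y.1 by ring)⟩
  have hσ₂ : Bijective σ₂ := by
    refine ⟨fun s t hst => Subtype.ext ?_, fun y => ?_⟩
    · have : 2 * s.1 - 1 = 2 * t.1 - 1 := congrArg Subtype.val hst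
      linarith
    · exact ⟨⟨(y.1 + 1) / 2, by have := y.2.1; linarith, by have := y.2.2; linarith⟩,
        Subtype.ext (show 2 * ((y.1 + 1) / 2) - 1 = y.1 by ring)⟩
  have l₁ : σ₁ (lpt h₀) = lpt zero_le_one := Subtype.ext (show 2 * (0:ℝ) = 0 by norm_num)
  have r₁ : σ₁ (rpt h₀) = rpt zero_le_one := Subtype.ext (show 2 * (1/2:ℝ) = 1 by norm_num)
  have l₂ : σ₂ (lpt h₁) = lpt zero_le_one := Subtype.ext (show 2 * (1/2:ℝ) - 1 = 0 by norm_num)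
  have r₂ : σ₂ (rpt h₁) = rpt zero_le_one := Subtype.ext (show 2 * (1:ℝ) - 1 = 1 by norm_num)
  have i₁ : Icc (0:ℝ) (1/2) ⊆ Icc 0 1 := Icc_subset_Icc le_rfl h₁
  have i₂ : Icc (1/2:ℝ) 1 ⊆ Icc 0 1 := Icc_subset_Icc h₀ le_rfl
  have e₁ : restr (prod01 γ₁ γ₂) i₁ = γ₁ ∘ σ₁ := funext fun s => dif_pos s.2.2
  have e₂ : restr (prod01 γ₁ γ₂) i₂ = γ₂ ∘ σ₂ := by
    funext s
    by_cases hs : s.1 ≤ 1/2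
    · obtain rfl : s = lpt h₁ := Subtype.ext (le_antisymm hs s.2.1)
      rw [comp_apply, l₂, ← hγ, ← r₁]
      exact dif_pos hs
    · exact dif_neg hs
  have k₁ := transport_eq_of_restr_eq_comp π T h15 h16 γ₁ (prod01 γ₁ γ₂) i₁ σ₁ hσ₁ e₁
    (lpt h₀) (rpt h₀) u (by rw [l₁, hu])
  rw [l₁, r₁] at k₁
  have hv : π (T.I 0 1 γ₁ (lpt zero_le_one) (rpt zero_le_one) u) = γ₂ (lpt zero_le_one) := by
    rw [T.maps_fibre 0 1 γ₁ _ _ u hu, hγ]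
  have k₂ := transport_eq_of_restr_eq_comp π T h15 h16 γ₂ (prod01 γ₁ γ₂) i₂ σ₂ hσ₂ e₂
    (lpt h₁) (rpt h₁) _ (hv.trans (congrArg γ₂ l₂.symm))
  rw [l₂, r₂, ← k₁] at k₂
  have hu' : π u = prod01 γ₁ γ₂ (inclusion i₁ (lpt h₀)) := by
    rw [hu, ← l₁]
    exact (congrFun e₁ (lpt h₀)).symm
  simp only [pTrans_of_le π T zero_le_one]
  rw [← k₁, ← k₂]
  exact (T.comp 0 1 (prod01 γ₁ γ₂) (inclusion i₂ (rpt h₁)) (inclusion i₁ (lpt h₀))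
    (inclusion i₁ (rpt h₀)) u hu').symm

/-- Theorem 3.1, first direction: if a transport along paths satisfies
(1.5) and (1.6), then `φ : γ ↦ φ_γ := I^γ_{a→b}` is an axiomatically defined parallel
transport, i.e. every `φ_γ` is a bijection between the corresponding fibres and
(2.11), (2.12), (2.13), (2.14) hold. -/
theorem stmt8 (π : E → B) (T : TransportAlongPaths π)
    (h15 : Cond15 π T.I) (h16 : Cond16 π T.I) :
    IsParTransport π (pTrans π T) := by
  refine ⟨?_, ?_, ?_, pTrans_prod01 π T h15 h16, ?_⟩
  · intro a b hab γ
    rw [pTrans_of_le π T hab]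
    exact InvOn.bijOn (f' := T.I a b γ (rpt hab) (lpt hab))
      ⟨fun u hu => transport_inv π T γ _ _ u hu, fun u hu => transport_inv π T γ _ _ u hu⟩
      (fun u hu => T.maps_fibre a b γ _ _ u hu) (fun u hu => T.maps_fibre a b γ _ _ u hu)
  · intro a b c d hab hcd γ τ hτ hm u hu
    have hl := strictMono_bijective_lpt hab hcd hτ hm
    have hr := strictMono_bijective_rpt hab hcd hτ hm
    rw [pTrans_of_le π T hab, pTrans_of_le π T hcd,
      h16 a b c d γ τ hτ (lpt hcd) (rpt hcd) u (by rw [hl, hu]), hl, hr]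
  · refine fun γ => ⟨fun u hu => ?_, fun u hu => ?_⟩
    · rw [pTrans_of_le π T zero_le_one γ,
        pTrans_inv01 π T h16 γ _ (T.maps_fibre 0 1 γ _ _ u hu), transport_inv π T γ _ _ u hu]
    · rw [pTrans_inv01 π T h16 γ u hu, pTrans_of_le π T zero_le_one γ,
        transport_inv π T γ _ _ u hu]
  · intro a γ u hu
    rw [pTrans_of_le π T le_rfl]
    exact T.id_eq a a γ _ u hu
end

section
/- (Proposition 4.4.) Let S be a transport along paths in (E,π,M) satisfying condition (1.5) and condition (4.4) for strictly increasing bijections τ, and define φ_η := S^η_{a→b} for each path η : [a,b] → M with a ≤ b. Then for all paths η₁, η₂ : [0,1] → M with η₁(1) = η₂(0), one has φ_{η₁η₂} = φ_{η₂} ∘ φ_{η₁} (equation (4.7)), where η₁η₂ is the canonical product path. -/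
open Set Function

variable {E B : Type*}

/-- If the restriction of `γ` to `[c,d]` is an increasing reparametrization `η ∘ τ` of `η`, then
the transport along `γ` between points of `[c,d]` is the transport along `η`. -/
theorem TransportAlongPaths.eq_of_restr_eq_comp {π : E → B} (S : TransportAlongPaths π)
    (h15 : Cond15 π S.I) (h44 : Cond16Inc π S.I) {a b c d a' b' : ℝ}
    {γ : Icc a b → B} {η : Icc a' b' → B} (h : Icc c d ⊆ Icc a b) (τ : Icc c d → Icc a' b')
    (hτ : Bijective τ) (hmono : StrictMono τ) (heq : restr γ h = η ∘ τ)
    (s t : Icc c d) (u : E) (hu : π u = η (τ s)) :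
    S.I a b γ (inclusion h s) (inclusion h t) u = S.I a' b' η (τ s) (τ t) u := by
  have hγ : γ (inclusion h s) = η (τ s) := congrFun heq s
  rw [← h15 a b c d γ h s t u (hu.trans hγ.symm), heq]
  exact h44 a' b' c d η τ hτ hmono s t u hu

/-- The increasing bijection `s ↦ 2s` from `[0,1/2]` onto `[0,1]`. -/
def doubleLeft (s : Icc (0:ℝ) (1/2)) : Icc (0:ℝ) 1 :=
  ⟨2 * s.1, by linarith [s.2.1], by linarith [s.2.2]⟩

/-- The increasing bijection `s ↦ 2s - 1` from `[1/2,1]` onto `[0,1]`. -/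
def doubleRight (s : Icc (1/2:ℝ) 1) : Icc (0:ℝ) 1 :=
  ⟨2 * s.1 - 1, by linarith [s.2.1], by linarith [s.2.2]⟩

theorem doubleLeft_strictMono : StrictMono doubleLeft := by
  intro s t hst
  have hlt : s.1 < t.1 := hst
  change 2 * s.1 < 2 * t.1
  linarith

theorem doubleRight_strictMono : StrictMono doubleRight := by
  intro s t hst
  have hlt : s.1 < t.1 := hst
  change 2 * s.1 - 1 < 2 * t.1 - 1
  linarith

theorem doubleLeft_bijective : Bijective doubleLeft := by
  refine ⟨doubleLeft_strictMono.injective, fun y => ⟨⟨y.1 / 2, ?_, ?_⟩, Subtype.ext ?_⟩⟩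
  · linarith [y.2.1]
  · linarith [y.2.2]
  · change 2 * (y.1 / 2) = y.1
    ring

theorem doubleRight_bijective : Bijective doubleRight := by
  refine ⟨doubleRight_strictMono.injective, fun y => ⟨⟨(y.1 + 1) / 2, ?_, ?_⟩, Subtype.ext ?_⟩⟩
  · linarith [y.2.1]
  · linarith [y.2.2]
  · change 2 * ((y.1 + 1) / 2) - 1 = y.1
    ring

theorem restr_prod01_left (γ₁ γ₂ : Icc (0:ℝ) 1 → B) (h : Icc (0:ℝ) (1/2) ⊆ Icc 0 1) :
    restr (prod01 γ₁ γ₂) h = γ₁ ∘ doubleLeft :=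
  funext fun s => dif_pos s.2.2

theorem restr_prod01_right {γ₁ γ₂ : Icc (0:ℝ) 1 → B}
    (hconn : γ₁ (rpt zero_le_one) = γ₂ (lpt zero_le_one)) (h : Icc (1/2:ℝ) 1 ⊆ Icc 0 1) :
    restr (prod01 γ₁ γ₂) h = γ₂ ∘ doubleRight := by
  funext s
  by_cases hs : s.1 ≤ 1/2
  · have hs' : s.1 = 1/2 := le_antisymm hs s.2.1
    refine (dif_pos hs).trans (Eq.trans (congrArg γ₁ (Subtype.ext ?_))
      (hconn.trans (congrArg γ₂ (Subtype.ext ?_))))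
    · change 2 * s.1 = 1
      linarith
    · change 0 = 2 * s.1 - 1
      linarith
  · exact dif_neg hs

/-- Proposition 4.4, equation (4.7): under condition (1.5) and
condition (4.4) for strictly increasing bijections, `φ_{η₁η₂} = φ_{η₂} ∘ φ_{η₁}` for
the canonical product `η₁η₂` of paths with `η₁(1) = η₂(0)`. -/
theorem stmt16 (π : E → B) (S : TransportAlongPaths π)
    (h15 : Cond15 π S.I) (h44 : Cond16Inc π S.I)
    (η₁ η₂ : Icc (0:ℝ) 1 → B) (hconn : η₁ (rpt zero_le_one) = η₂ (lpt zero_le_one)) :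
    ∀ u : E, π u = η₁ (lpt zero_le_one) →
      ppt π S zero_le_one (prod01 η₁ η₂) u =
        ppt π S zero_le_one η₂ (ppt π S zero_le_one η₁ u) := by
  intro u hu
  have hl : Icc (0:ℝ) (1/2) ⊆ Icc 0 1 := Icc_subset_Icc le_rfl (by norm_num)
  have hr : Icc (1/2:ℝ) 1 ⊆ Icc 0 1 := Icc_subset_Icc (by norm_num) le_rfl
  have h0 : (0:ℝ) ≤ 1/2 := by norm_num
  have h1 : (1/2:ℝ) ≤ 1 := by norm_num
  have el0 : doubleLeft (lpt h0) = lpt zero_le_one :=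
    Subtype.ext (show (2:ℝ) * 0 = 0 by norm_num)
  have el1 : doubleLeft (rpt h0) = rpt zero_le_one :=
    Subtype.ext (show (2:ℝ) * (1/2) = 1 by norm_num)
  have er0 : doubleRight (lpt h1) = lpt zero_le_one :=
    Subtype.ext (show (2:ℝ) * (1/2) - 1 = 0 by norm_num)
  have er1 : doubleRight (rpt h1) = rpt zero_le_one :=
    Subtype.ext (show (2:ℝ) * 1 - 1 = 1 by norm_num)
  have left := S.eq_of_restr_eq_comp h15 h44 hl doubleLeft doubleLeft_bijective
    doubleLeft_strictMono (restr_prod01_left η₁ η₂ hl) (lpt h0) (rpt h0) u (by rw [el0, hu])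
  have hmid : π (S.I 0 1 η₁ (lpt zero_le_one) (rpt zero_le_one) u) = η₂ (lpt zero_le_one) :=
    (S.maps_fibre 0 1 η₁ _ _ u hu).trans hconn
  have right := S.eq_of_restr_eq_comp h15 h44 hr doubleRight doubleRight_bijective
    doubleRight_strictMono (restr_prod01_right hconn hr) (lpt h1) (rpt h1) _
    (by rw [er0]; exact hmid)
  have hstart : π u = prod01 η₁ η₂ (inclusion hl (lpt h0)) := by
    have := congrFun (restr_prod01_left η₁ η₂ hl) (lpt h0)
    rw [comp_apply, el0] at this
    exact hu.trans this.symm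
  rw [el0, el1] at left
  rw [er0, er1, ← left] at right
  rw [ppt, ppt, ppt, ← left, ← right]
  exact (S.comp 0 1 (prod01 η₁ η₂) _ _ _ u hstart).symm
end
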